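/- For the Pareto mixing setup with α > 2, a = 0, φ_l = φ_l^{(0)} and U_l(x) = −x^{α+1} ∫_x^∞ z^{−α−1} φ_l(z)dz + x φ_l(x): for any fixed θ_o > 1 there exists a constant c > 0 (independent of l) such that for every integer l ≥ 0, ∫_{θ_o}^∞ U_l^2(x)dx ≤ c (l^{7/3} ∨ 1). -/

import Mathlib

open MeasureTheory Real

/-- Generalized Laguerre polynomial `L_k^{(a)}(x)`. -/
noncomputable def genLagPoly (a : ℝ) (k : ℕ) (x : ℝ) : ℝ :=
  ∑ i ∈ Finset.range (k + 1),
    (-1 : ℝ) ^ i * (Real.Gamma ((k : ℝ) + a + 1) /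
      (Real.Gamma (a + i + 1) * (Nat.factorial (k - i)))) * x ^ i / (Nat.factorial i)

/-- Generalized Laguerre function `φ_k^{(a)}(x)`. -/
noncomputable def lagFun (a : ℝ) (k : ℕ) (x : ℝ) : ℝ :=
  Real.sqrt ((Nat.factorial k : ℝ) / Real.Gamma ((k : ℝ) + a + 1)) *
    Real.exp (-x / 2) * x ^ (a / 2) * genLagPoly a k x

/-- `U_l` for the Pareto mixing distribution:
`U_l(x) = −x^{α+1}∫_x^∞ z^{−α−1}φ_l(z)dz + xφ_l(x)`, with `a = 0`. -/
noncomputable def Upareto (α : ℝ) (l : ℕ) (x : ℝ) : ℝ :=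
  -(x ^ (α + 1)) * (∫ z in Set.Ioi x, z ^ (-(α + 1)) * lagFun 0 l z) + x * lagFun 0 l x

/-- Iterated forward differences of a binomial coefficient, including the vanishing range. -/
lemma fwdDiff_iter_choose_eq_ite (l n : ℕ) (y : ℕ) :
    (fwdDiff 1)^[l] (fun x ↦ x.choose n : ℕ → ℤ) y =
      if l ≤ n then (y.choose (n - l) : ℤ) else 0 := by
  split_ifs with h
  · obtain ⟨d, rfl⟩ := Nat.exists_eq_add_of_le h
    simpa [add_comm] using congrFun (fwdDiff_iter_choose d l) y
  · obtain ⟨d, rfl⟩ := Nat.exists_eq_add_of_lt (not_le.mp h)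
    have h0 : (fwdDiff 1)^[n] (fun x ↦ x.choose n : ℕ → ℤ) = fun _ ↦ 1 := by
      simpa using fwdDiff_iter_choose 0 n
    rw [show n + d + 1 = (d + 1) + n by ring, Function.iterate_add_apply, h0,
      Function.iterate_succ_apply, fwdDiff_const]
    simp [fwdDiff_iter_eq_sum_shift]

lemma sum_neg_one_pow_mul_choose_mul_choose_add (l n : ℕ) :
    ∑ j ∈ Finset.range (l + 1), (-1 : ℝ) ^ j * l.choose j * (n + j).choose n =
      (-1) ^ l * n.choose l := by
  have h := fwdDiff_iter_choose_eq_ite l n n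
  rw [fwdDiff_iter_eq_sum_shift] at h
  have h' : (if l ≤ n then (n.choose (n - l) : ℤ) else 0) = n.choose l := by
    split_ifs with hl
    · rw [Nat.choose_symm hl]
    · rw [Nat.choose_eq_zero_of_lt (not_le.mp hl), Nat.cast_zero]
  rw [h'] at h
  have h2 := congrArg (fun t : ℤ ↦ (-1 : ℝ) ^ l * (t : ℝ)) h
  simp only [Int.cast_natCast] at h2
  rw [← h2]
  push_cast
  rw [Finset.mul_sum]
  refine Finset.sum_congr rfl fun j hj ↦ ?_
  obtain ⟨d, rfl⟩ := Nat.exists_eq_add_of_le (Nat.lt_succ_iff.mp (Finset.mem_range.mp hj))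
  have hd : (-1 : ℝ) ^ d * (-1) ^ d = 1 := by rw [← mul_pow]; simp
  simp only [add_tsub_cancel_left, smul_eq_mul, mul_one, pow_add]
  push_cast
  linear_combination (-(-1 : ℝ) ^ j * (j + d).choose j * (n + j).choose n) * hd

lemma lagFun_zero_eq (l : ℕ) (x : ℝ) :
    lagFun 0 l x =
      exp (-x / 2) * ∑ i ∈ Finset.range (l + 1), (-1 : ℝ) ^ i * l.choose i / i.factorial * x ^ i := by
  have hl : (l.factorial : ℝ) ≠ 0 := by positivity
  simp only [lagFun, genLagPoly, add_zero, zero_add, zero_div, rpow_zero, mul_one,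
    Real.Gamma_nat_eq_factorial, div_self hl, sqrt_one, one_mul]
  congr 1
  refine Finset.sum_congr rfl fun i hi ↦ ?_
  rw [Nat.cast_choose ℝ (Nat.lt_succ_iff.mp (Finset.mem_range.mp hi))]
  ring

lemma continuous_lagFun_zero (l : ℕ) : Continuous (lagFun 0 l) := by
  rw [funext (lagFun_zero_eq l)]
  fun_prop

lemma integrableOn_exp_neg_mul_pow (n : ℕ) :
    IntegrableOn (fun x : ℝ ↦ exp (-x) * x ^ n) (Set.Ioi 0) := by
  have h := Real.GammaIntegral_convergent (s := n + 1) (by positivity)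
  simpa using h

lemma integral_exp_neg_mul_pow (n : ℕ) :
    ∫ x in Set.Ioi (0 : ℝ), exp (-x) * x ^ n = n.factorial := by
  rw [← Real.Gamma_nat_eq_factorial, Real.Gamma_eq_integral (by positivity)]
  simp

lemma sq_mul_lagFun_zero_eq (l : ℕ) (x : ℝ) :
    (x * lagFun 0 l x) ^ 2 =
      ∑ i ∈ Finset.range (l + 1), ∑ j ∈ Finset.range (l + 1),
        ((-1 : ℝ) ^ i * l.choose i / i.factorial) * ((-1 : ℝ) ^ j * l.choose j / j.factorial) *
          (exp (-x) * x ^ (i + 2 + j)) := by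
  have hx : exp (-x) = exp (-x / 2) ^ 2 := by rw [← exp_nat_mul]; congr 1; push_cast; ring
  rw [lagFun_zero_eq, hx, mul_pow, mul_pow, sq (∑ i ∈ _, _), Finset.sum_mul_sum]
  simp only [Finset.mul_sum]
  refine Finset.sum_congr rfl fun i _ ↦ Finset.sum_congr rfl fun j _ ↦ ?_
  ring

lemma integrableOn_sq_mul_lagFun_zero (l : ℕ) :
    IntegrableOn (fun x ↦ (x * lagFun 0 l x) ^ 2) (Set.Ioi 0) := by
  simp only [sq_mul_lagFun_zero_eq]
  exact integrable_finsetSum _ fun i _ ↦ integrable_finsetSum _ fun j _ ↦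
    (integrableOn_exp_neg_mul_pow _).const_mul _

lemma integral_sq_mul_lagFun_zero_eq_sum (l : ℕ) :
    ∫ x in Set.Ioi (0 : ℝ), (x * lagFun 0 l x) ^ 2 =
      ∑ i ∈ Finset.range (l + 1),
        (-1 : ℝ) ^ (i + l) * l.choose i * ((i + 1) * (i + 2)) * (i + 2).choose l := by
  simp only [sq_mul_lagFun_zero_eq]
  rw [integral_finsetSum _ fun i _ ↦ integrable_finsetSum _ fun j _ ↦
    (integrableOn_exp_neg_mul_pow _).const_mul _]
  refine Finset.sum_congr rfl fun i _ ↦ ?_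
  rw [integral_finsetSum _ fun j _ ↦ (integrableOn_exp_neg_mul_pow _).const_mul _]
  simp only [integral_const_mul, integral_exp_neg_mul_pow]
  have h := sum_neg_one_pow_mul_choose_mul_choose_add l (i + 2)
  have hi : (i.factorial : ℝ) ≠ 0 := by positivity
  calc _ = (-1 : ℝ) ^ i * l.choose i * ((i + 1) * (i + 2)) *
        ∑ j ∈ Finset.range (l + 1), (-1 : ℝ) ^ j * l.choose j * (i + 2 + j).choose (i + 2) := by
        rw [Finset.mul_sum]
        refine Finset.sum_congr rfl fun j _ ↦ ?_
        have hj : (j.factorial : ℝ) ≠ 0 := by positivity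
        rw [Nat.choose_symm_add, ← Nat.add_choose_mul_factorial_mul_factorial (i + 2) j]
        simp only [Nat.factorial_succ]
        push_cast
        field_simp
        ring
    _ = _ := by rw [h, pow_add]; ring

lemma integral_sq_mul_lagFun_zero (l : ℕ) :
    ∫ x in Set.Ioi (0 : ℝ), (x * lagFun 0 l x) ^ 2 = 6 * l ^ 2 + 6 * l + 2 := by
  rw [integral_sq_mul_lagFun_zero_eq_sum]
  match l with
  | 0 => norm_num
  | 1 => norm_num [Finset.sum_range_succ, Nat.choose]
  | m + 2 =>
    rw [Finset.sum_range_succ, Finset.sum_range_succ, Finset.sum_range_succ, Finset.sum_eq_zero]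
    · have h1 : ((m + 2).choose m : ℝ) = (m + 2) * (m + 1) / 2 := by
        rw [Nat.choose_symm_add, Nat.cast_choose_two]
        push_cast; ring
      have h2 : ((m + 2).choose (m + 1) : ℝ) = m + 2 := by
        rw [Nat.choose_succ_self_right]; push_cast; ring
      have h3 : ((m + 1 + 2).choose (m + 2) : ℝ) = m + 3 := by
        rw [Nat.choose_succ_self_right]; push_cast; ring
      have h4 : ((m + 2 + 2).choose (m + 2) : ℝ) = (m + 4) * (m + 3) / 2 := by
        rw [Nat.choose_symm_add, Nat.cast_choose_two]
        push_cast; ring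
      have hm : (-1 : ℝ) ^ m * (-1) ^ m = 1 := by rw [← mul_pow]; simp
      rw [h1, h2, h3, h4, Nat.choose_self]
      simp only [pow_add]
      push_cast
      linear_combination (6 * ((m : ℝ) + 2) ^ 2 + 6 * (m + 2) + 2) * hm
    · intro i hi
      rw [Nat.choose_eq_zero_of_lt (n := i + 2) (by have := Finset.mem_range.mp hi; omega)]
      simp

lemma lintegral_Ioi_inv_sq {x : ℝ} (hx : 0 < x) :
    ∫⁻ z in Set.Ioi x, ENNReal.ofReal (z ^ (-1 : ℝ)) ^ (2 : ℝ) = ENNReal.ofReal x⁻¹ := by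
  have h : ∀ z ∈ Set.Ioi x, ENNReal.ofReal (z ^ (-1 : ℝ)) ^ (2 : ℝ) =
      ENNReal.ofReal (z ^ (-2 : ℝ)) := fun z hz ↦ by
    have hz0 : (0 : ℝ) < z := hx.trans hz
    rw [ENNReal.ofReal_rpow_of_pos (by positivity), ← rpow_mul hz0.le]
    norm_num
  rw [setLIntegral_congr_fun measurableSet_Ioi h, ← ofReal_integral_eq_lintegral_ofReal
    (integrableOn_Ioi_rpow_of_lt (by norm_num) hx)
    ((ae_restrict_mem measurableSet_Ioi).mono fun z hz ↦ rpow_nonneg (hx.trans hz).le _),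
    integral_Ioi_rpow_of_lt (by norm_num) hx]
  norm_num [rpow_neg_one]

lemma lintegral_Ioo_rpow {s z : ℝ} (hs : -1 < s) (hz : 0 < z) :
    ∫⁻ x in Set.Ioo 0 z, ENNReal.ofReal (x ^ s) = ENNReal.ofReal (z ^ (s + 1) / (s + 1)) := by
  have hi : IntegrableOn (fun x : ℝ ↦ x ^ s) (Set.Ioc 0 z) :=
    (intervalIntegrable_iff_integrableOn_Ioc_of_le hz.le).mp
      (intervalIntegral.intervalIntegrable_rpow' hs)
  rw [setLIntegral_congr Ioo_ae_eq_Ioc, ← ofReal_integral_eq_lintegral_ofReal hi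
    ((ae_restrict_mem measurableSet_Ioc).mono fun x hx ↦ rpow_nonneg hx.1.le _),
    ← intervalIntegral.integral_of_le hz.le, integral_rpow (Or.inl hs),
    zero_rpow (by linarith), sub_zero]

/-- Cauchy–Schwarz bound for the tail integral in the weighted Hardy inequality. -/
lemma ofReal_sq_rpow_mul_integral_Ioi_le {f : ℝ → ℝ} (hf : Measurable f) (α : ℝ) {x : ℝ}
    (hx : 0 < x) :
    ENNReal.ofReal ((x ^ (α + 1) * ∫ z in Set.Ioi x, z ^ (-(α + 1)) * f z) ^ 2) ≤
      ENNReal.ofReal (x ^ (2 * α + 1)) *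
        ∫⁻ z in Set.Ioi x, ENNReal.ofReal ((z ^ (-α) * f z) ^ 2) := by
  have h1 : ENNReal.ofReal |∫ z in Set.Ioi x, z ^ (-(α + 1)) * f z| ≤
      ∫⁻ z in Set.Ioi x, ENNReal.ofReal (z ^ (-1 : ℝ)) * ENNReal.ofReal |z ^ (-α) * f z| := by
    rw [← Real.norm_eq_abs, ofReal_norm]
    refine (enorm_integral_le_lintegral_enorm _).trans_eq
      (setLIntegral_congr_fun measurableSet_Ioi fun z hz ↦ ?_)
    have hz0 : (0 : ℝ) < z := hx.trans hz
    rw [← ENNReal.ofReal_mul (by positivity), ← ofReal_norm, Real.norm_eq_abs, neg_add,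
      rpow_add hz0, abs_mul, abs_mul, abs_mul, abs_of_pos (rpow_pos_of_pos hz0 (-1))]
    congr 1; ring
  have h2 := h1.trans (ENNReal.lintegral_mul_le_Lp_mul_Lq _ Real.HolderConjugate.two_two
    (by fun_prop) (by fun_prop))
  rw [lintegral_Ioi_inv_sq hx] at h2
  have h3 : ∀ z : ℝ, ENNReal.ofReal |z ^ (-α) * f z| ^ (2 : ℝ) =
      ENNReal.ofReal ((z ^ (-α) * f z) ^ 2) := fun z ↦ by
    rw [ENNReal.ofReal_rpow_of_nonneg (abs_nonneg _) (by norm_num), rpow_two, sq_abs]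
  simp only [h3] at h2
  have h4 := pow_le_pow_left' h2 2
  rw [mul_pow, ← ENNReal.rpow_mul_natCast, ← ENNReal.rpow_mul_natCast] at h4
  rw [show 1 / (2 : ℝ) * (2 : ℕ) = 1 by norm_num, ENNReal.rpow_one, ENNReal.rpow_one,
    ← ENNReal.ofReal_pow (abs_nonneg _), sq_abs] at h4
  rw [mul_pow, ENNReal.ofReal_mul (by positivity)]
  refine (mul_le_mul_right h4 _).trans_eq ?_
  rw [← mul_assoc, ← ENNReal.ofReal_mul (by positivity)]
  congr 2
  rw [← rpow_natCast, ← rpow_mul hx.le, ← rpow_neg_one, ← rpow_add hx]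
  congr 1; push_cast; ring

lemma lintegral_Ioi_mul_lintegral_Ioi {w g : ℝ → ENNReal} (hw : Measurable w)
    (hg : Measurable g) :
    ∫⁻ x in Set.Ioi (0 : ℝ), w x * ∫⁻ z in Set.Ioi x, g z =
      ∫⁻ z in Set.Ioi (0 : ℝ), g z * ∫⁻ x in Set.Ioo 0 z, w x := by
  have hl : ∀ x, (Set.Ioi (0 : ℝ)).indicator (fun x ↦ w x * ∫⁻ z in Set.Ioi x, g z) x =
      ∫⁻ z, {p : ℝ × ℝ | 0 < p.1 ∧ p.1 < p.2}.indicator (fun p ↦ w p.1 * g p.2) (x, z) := by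
    intro x
    by_cases hx : 0 < x
    · rw [Set.indicator_of_mem (by exact hx), ← lintegral_indicator measurableSet_Ioi,
        ← lintegral_const_mul _ (hg.indicator measurableSet_Ioi)]
      refine lintegral_congr fun z ↦ ?_
      by_cases hz : x < z <;> simp [Set.indicator, hx, hz]
    · simp [Set.indicator, hx]
  have hr : ∀ z, (Set.Ioi (0 : ℝ)).indicator (fun z ↦ g z * ∫⁻ x in Set.Ioo 0 z, w x) z =
      ∫⁻ x, {p : ℝ × ℝ | 0 < p.1 ∧ p.1 < p.2}.indicator (fun p ↦ w p.1 * g p.2) (x, z) := by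
    intro z
    by_cases hz : 0 < z
    · rw [Set.indicator_of_mem (by exact hz), ← lintegral_indicator measurableSet_Ioo,
        ← lintegral_const_mul _ (hw.indicator measurableSet_Ioo)]
      refine lintegral_congr fun x ↦ ?_
      by_cases hx : 0 < x ∧ x < z <;> simp [Set.indicator, hx, mul_comm]
    · have : ∀ x : ℝ, ¬ (0 < x ∧ x < z) := fun x hx ↦ hz (hx.1.trans hx.2)
      simp [Set.indicator, hz, this]
  rw [← lintegral_indicator measurableSet_Ioi, ← lintegral_indicator measurableSet_Ioi,
    lintegral_congr hl, lintegral_congr hr]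
  refine lintegral_lintegral_swap (Measurable.aemeasurable ?_)
  exact Measurable.indicator (by fun_prop)
    ((measurableSet_lt measurable_const measurable_fst).inter
      (measurableSet_lt measurable_fst measurable_snd))

/-- A weighted Hardy inequality for tail integrals. -/
lemma lintegral_Ioi_hardy {f : ℝ → ℝ} (hf : Measurable f) {α : ℝ} (hα : -1 < α) :
    ∫⁻ x in Set.Ioi (0 : ℝ),
        ENNReal.ofReal ((x ^ (α + 1) * ∫ z in Set.Ioi x, z ^ (-(α + 1)) * f z) ^ 2) ≤
      ENNReal.ofReal (1 / (2 * α + 2)) *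
        ∫⁻ x in Set.Ioi (0 : ℝ), ENNReal.ofReal ((x * f x) ^ 2) := by
  refine (setLIntegral_mono' measurableSet_Ioi fun x hx ↦
    ofReal_sq_rpow_mul_integral_Ioi_le hf α hx).trans_eq ?_
  rw [lintegral_Ioi_mul_lintegral_Ioi (by fun_prop) (by fun_prop),
    ← lintegral_const_mul _ (by fun_prop)]
  refine setLIntegral_congr_fun measurableSet_Ioi fun z hz ↦ ?_
  have hz0 : (0 : ℝ) < z := hz
  have hα' : 0 < 2 * α + 2 := by linarith
  rw [lintegral_Ioo_rpow (by linarith) hz0, ← ENNReal.ofReal_mul (by positivity),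
    ← ENNReal.ofReal_mul (by positivity)]
  congr 1
  have h : (z ^ (-α)) ^ 2 * z ^ (2 * α + 1 + 1) = z ^ 2 := by
    rw [← rpow_natCast, ← rpow_mul hz0.le, ← rpow_add hz0, ← rpow_natCast]
    congr 1; push_cast; ring
  rw [show 2 * α + 1 + 1 = 2 * α + 2 by ring] at h ⊢
  rw [mul_pow, mul_pow, ← h]
  ring

lemma integral_Ioi_sq_Upareto_le {α : ℝ} (hα : 0 ≤ α) {θo : ℝ} (hθo : 0 ≤ θo) (l : ℕ) :
    ∫ x in Set.Ioi θo, (Upareto α l x) ^ 2 ≤ 4 * (6 * (l : ℝ) ^ 2 + 6 * l + 2) := by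
  have hm : Measurable (lagFun 0 l) := (continuous_lagFun_zero l).measurable
  set H : ℝ → ℝ := fun x ↦ x ^ (α + 1) * ∫ z in Set.Ioi x, z ^ (-(α + 1)) * lagFun 0 l z with hH
  have hsq : ∀ x, ‖(Upareto α l x) ^ 2‖ₑ ≤
      2 * (ENNReal.ofReal (H x ^ 2) + ENNReal.ofReal ((x * lagFun 0 l x) ^ 2)) := fun x ↦ by
    have hU : Upareto α l x = x * lagFun 0 l x - H x := by simp only [Upareto, hH]; ring
    rw [← ENNReal.ofReal_add (by positivity) (by positivity), ← ENNReal.ofReal_ofNat 2,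
      ← ENNReal.ofReal_mul (by norm_num), ← ofReal_norm, Real.norm_of_nonneg (sq_nonneg _),
      hU]
    exact ENNReal.ofReal_le_ofReal (by nlinarith [sq_nonneg (x * lagFun 0 l x + H x)])
  have hint : ∫⁻ x in Set.Ioi (0 : ℝ), ENNReal.ofReal ((x * lagFun 0 l x) ^ 2) =
      ENNReal.ofReal (6 * (l : ℝ) ^ 2 + 6 * l + 2) := by
    rw [← integral_sq_mul_lagFun_zero, ofReal_integral_eq_lintegral_ofReal
      (integrableOn_sq_mul_lagFun_zero l) (ae_of_all _ fun _ ↦ sq_nonneg _)]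
  have hhardy : ∫⁻ x in Set.Ioi (0 : ℝ), ENNReal.ofReal (H x ^ 2) ≤
      ENNReal.ofReal (6 * (l : ℝ) ^ 2 + 6 * l + 2) := by
    refine (lintegral_Ioi_hardy hm (by linarith)).trans ?_
    rw [hint]
    refine mul_le_of_le_one_left' (ENNReal.ofReal_le_one.mpr ?_)
    rw [div_le_one (by linarith)]
    linarith
  have key : ‖∫ x in Set.Ioi θo, (Upareto α l x) ^ 2‖ₑ ≤
      ENNReal.ofReal (4 * (6 * (l : ℝ) ^ 2 + 6 * l + 2)) :=
    calc _ ≤ ∫⁻ x in Set.Ioi θo, ‖(Upareto α l x) ^ 2‖ₑ := enorm_integral_le_lintegral_enorm _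
      _ ≤ ∫⁻ x in Set.Ioi (0 : ℝ), ‖(Upareto α l x) ^ 2‖ₑ :=
        lintegral_mono_set (Set.Ioi_subset_Ioi hθo)
      _ ≤ ∫⁻ x in Set.Ioi (0 : ℝ),
          2 * (ENNReal.ofReal (H x ^ 2) + ENNReal.ofReal ((x * lagFun 0 l x) ^ 2)) :=
        lintegral_mono hsq
      _ = 2 * ((∫⁻ x in Set.Ioi (0 : ℝ), ENNReal.ofReal (H x ^ 2)) +
          ∫⁻ x in Set.Ioi (0 : ℝ), ENNReal.ofReal ((x * lagFun 0 l x) ^ 2)) := by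
        rw [lintegral_const_mul' _ _ (by norm_num), lintegral_add_right _ (by fun_prop)]
      _ ≤ 2 * (ENNReal.ofReal (6 * (l : ℝ) ^ 2 + 6 * l + 2) +
          ENNReal.ofReal (6 * (l : ℝ) ^ 2 + 6 * l + 2)) := by
        rw [hint]; gcongr
      _ = _ := by
        rw [← ENNReal.ofReal_add (by positivity) (by positivity), ← ENNReal.ofReal_ofNat 2,
          ← ENNReal.ofReal_mul (by norm_num)]
        congr 1; ring
  rw [← ofReal_norm, ENNReal.ofReal_le_ofReal_iff (by positivity)] at key
  exact (le_abs_self _).trans key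

/-- For the Pareto mixing setup with `α > 2` and any fixed `θ_o > 1`, there
is a constant `c > 0` independent of `l` with `∫_{θ_o}^∞ U_l² ≤ c(l^{7/3} ∨ 1)`. -/
theorem pareto_U_norm_bound (α : ℝ) (hα : 2 < α) (θo : ℝ) (hθo : 1 < θo) :
    ∃ c : ℝ, 0 < c ∧ ∀ l : ℕ,
      (∫ x in Set.Ioi θo, (Upareto α l x) ^ 2) ≤ c * max ((l : ℝ) ^ ((7 : ℝ) / 3)) 1 := by
  refine ⟨56, by norm_num, fun l ↦
    (integral_Ioi_sq_Upareto_le (by linarith) (by linarith) l).trans ?_⟩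
  rcases Nat.eq_zero_or_pos l with rfl | hl
  · norm_num
  · have h1 : (1 : ℝ) ≤ l := by exact_mod_cast hl
    have h2 : (l : ℝ) ^ 2 ≤ (l : ℝ) ^ ((7 : ℝ) / 3) := by
      rw [← rpow_natCast]
      exact rpow_le_rpow_of_exponent_le h1 (by norm_num)
    have h3 := le_max_left ((l : ℝ) ^ ((7 : ℝ) / 3)) 1
    nlinarith
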